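/- Let Ω ⊆ ℝⁿ, n ≥ 2, be a bounded domain with B(0,2) ⊆ Ω and let φ : Ω → ℝⁿ be K-quasiconformal. Let C₁ be the constant in the reduced reverse Hölder inequality for |Dφ|. Then for every p with n < p < n + (n−1)/(10^{2n}·4ⁿ·C₁ⁿ), one has ((1/|B(0,1)|)∫_{B(0,1)} |Dφ(x)|^p dx)^{1/p} ≤ 2^{1+n/p}·100ⁿ · ((1/|B(0,2)|)∫_{B(0,2)} |Dφ(x)|ⁿ dx)^{1/n}. -/

import Mathlib

open MeasureTheory ENNReal Metric

lemma gehring_abs {α : Type*} [MeasurableSpace α] (μ : Measure α) [SFinite μ] (n : ℕ) (hn : 2 ≤ n)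
    (F : α → ℝ) (hF : Measurable F) (hF0 : ∀ x, 0 ≤ F x)
    (N : ℝ≥0∞) (hN : ∫⁻ x, ENNReal.ofReal (F x) ^ n ∂μ = N) (hNtop : N ≠ ∞)
    (M s0 : ℝ) (hM : 0 ≤ M) (hs0 : 0 ≤ s0)
    (hlev : ∀ s, s0 < s → ∫⁻ x in {x | s < F x}, ENNReal.ofReal (F x) ^ n ∂μ
      ≤ ENNReal.ofReal (M * s ^ (n-1)) * ∫⁻ x in {x | s < F x}, ENNReal.ofReal (F x) ∂μ)
    (p : ℝ) (hp : (n:ℝ) < p) (hpM : 2 * (M * (p - n)) ≤ n - 1) :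
    ∫⁻ x, ENNReal.ofReal (F x) ^ p ∂μ ≤ 2 * (N * ENNReal.ofReal s0 ^ (p - n)) := by
  have hn' : (2:ℝ) ≤ n := by exact_mod_cast hn
  have hpn : 0 < p - n := by linarith
  have hp1 : 0 < p - 1 := by linarith
  -- truncated estimate
  have key : ∀ T : ℝ, 0 < T → ∫⁻ x, ENNReal.ofReal (F x) ^ n * ENNReal.ofReal ((min (F x) T) ^ (p - n)) ∂μ
      ≤ 2 * (N * ENNReal.ofReal s0 ^ (p - n)) := by
    intro T hT
    set Y := ∫⁻ x, ENNReal.ofReal (F x) ^ n * ENNReal.ofReal ((min (F x) T) ^ (p - n)) ∂μ with hY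
    have hYtop : Y ≠ ∞ := by
      have : Y ≤ ∫⁻ x, ENNReal.ofReal (F x) ^ n * ENNReal.ofReal (T ^ (p - n)) ∂μ := by
        apply lintegral_mono
        intro x
        dsimp only
        gcongr
        · exact le_min (hF0 x) hT.le
        · exact min_le_right _ _
      refine ne_top_of_le_ne_top ?_ this
      rw [lintegral_mul_const' _ _ ofReal_ne_top, hN]
      exact ENNReal.mul_ne_top hNtop ofReal_ne_top
    have hgm : Measurable fun x => min (F x) T := hF.min measurable_const
    have hgn : ∀ x, 0 ≤ min (F x) T := fun x => le_min (hF0 x) hT.le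
    have hm1 : Measurable fun x => ENNReal.ofReal (F x) := hF.ennreal_ofReal
    have hmn : Measurable fun x => ENNReal.ofReal (F x) ^ n := hm1.pow_const n
    have lay1 := lintegral_rpow_eq_lintegral_meas_lt_mul
      (μ.withDensity fun x => ENNReal.ofReal (F x) ^ n) (f := fun x => min (F x) T)
      (Filter.Eventually.of_forall hgn) hgm.aemeasurable hpn
    have lay2 := lintegral_rpow_eq_lintegral_meas_lt_mul
      (μ.withDensity fun x => ENNReal.ofReal (F x)) (f := fun x => min (F x) T)
      (Filter.Eventually.of_forall hgn) hgm.aemeasurable hp1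
    have hmp : ∀ q : ℝ, Measurable fun x => ENNReal.ofReal ((min (F x) T) ^ q) := fun q =>
      (hgm.pow_const q).ennreal_ofReal
    rw [lintegral_withDensity_eq_lintegral_mul _ hmn (hmp _)] at lay1
    rw [lintegral_withDensity_eq_lintegral_mul _ hm1 (hmp _)] at lay2
    have hms : ∀ t, MeasurableSet {a | t < min (F a) T} := fun t => measurableSet_lt measurable_const hgm
    simp only [withDensity_apply _ (hms _), Pi.mul_apply] at lay1 lay2
    -- pointwise in t
    have pt : ∀ t ∈ Set.Ioi (0:ℝ),
        (∫⁻ a in {a | t < min (F a) T}, ENNReal.ofReal (F a) ^ n ∂μ) * ENNReal.ofReal (t ^ (p - n - 1))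
        ≤ ENNReal.ofReal M * ((∫⁻ a in {a | t < min (F a) T}, ENNReal.ofReal (F a) ∂μ) * ENNReal.ofReal (t ^ (p - 1 - 1)))
          + (Set.Ioc 0 s0).indicator (fun t => N * ENNReal.ofReal (t ^ (p - n - 1))) t := by
      intro t ht
      have ht : 0 < t := ht
      by_cases hts : s0 < t
      · refine le_add_right ?_
        by_cases htT : t < T
        · have : {a | t < min (F a) T} = {a | t < F a} := by
            ext a; simp [htT]
          rw [this]
          calc _ ≤ (ENNReal.ofReal (M * t ^ (n-1)) * ∫⁻ x in {x | t < F x}, ENNReal.ofReal (F x) ∂μ) * ENNReal.ofReal (t ^ (p - n - 1)) := by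
                gcongr; exact hlev t hts
            _ = _ := by
              have : t ^ (p - 1 - 1) = t ^ (n-1) * t ^ (p - n - 1) := by
                rw [← Real.rpow_natCast, ← Real.rpow_add ht]
                congr 1
                rw [Nat.cast_sub (by omega)]; push_cast; ring
              rw [this, ENNReal.ofReal_mul hM, ENNReal.ofReal_mul (by positivity)]
              ring
        · have : {a | t < min (F a) T} = ∅ := by
            ext a; simp; intro _; linarith
          rw [this]; simp
      · refine le_add_left ?_
        rw [Set.indicator_of_mem (show t ∈ Set.Ioc 0 s0 from ⟨ht, not_lt.1 hts⟩)]
        gcongr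
        rw [← hN]; exact setLIntegral_le_lintegral _ _
    have hint : ∫⁻ t in Set.Ioc 0 s0, ENNReal.ofReal (t ^ (p - n - 1)) = ENNReal.ofReal (s0 ^ (p-n) / (p - n)) := by
      rw [← ofReal_integral_eq_lintegral_ofReal]
      · rw [← intervalIntegral.integral_of_le hs0, integral_rpow (Or.inl (by linarith))]
        rw [sub_add_cancel, Real.zero_rpow hpn.ne', sub_zero]
      · have := intervalIntegral.intervalIntegrable_rpow' (a := 0) (b := s0) (r := p - n - 1) (by linarith)
        rwa [intervalIntegrable_iff_integrableOn_Ioc_of_le hs0] at this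
      · filter_upwards [ae_restrict_mem measurableSet_Ioc] with t ht
        exact Real.rpow_nonneg ht.1.le _
    have hI := setLIntegral_mono' (μ := volume) measurableSet_Ioi pt
    set I2 := ∫⁻ t in Set.Ioi (0:ℝ), (∫⁻ a in {a | t < min (F a) T}, ENNReal.ofReal (F a) ∂μ) * ENNReal.ofReal (t ^ (p - 1 - 1)) with hI2
    have hI' : ∫⁻ t in Set.Ioi (0:ℝ), (∫⁻ a in {a | t < min (F a) T}, ENNReal.ofReal (F a) ^ n ∂μ) * ENNReal.ofReal (t ^ (p - n - 1))
        ≤ ENNReal.ofReal M * I2 + N * ENNReal.ofReal (s0 ^ (p-n) / (p - n)) := by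
      refine hI.trans ?_
      rw [lintegral_add_right _ (by
        apply Measurable.indicator _ measurableSet_Ioc
        fun_prop)]
      gcongr
      · rw [lintegral_const_mul' _ _ ofReal_ne_top]
      · rw [lintegral_indicator measurableSet_Ioc, Measure.restrict_restrict measurableSet_Ioc,
          lintegral_const_mul' _ _ hNtop, Set.inter_eq_left.2 Set.Ioc_subset_Ioi_self, hint]
    have hW : ENNReal.ofReal (p-1) * I2 ≤ Y := by
      rw [← lay2, hY]
      apply lintegral_mono
      intro x
      dsimp only
      rw [← ENNReal.ofReal_pow (hF0 x), ← ENNReal.ofReal_mul (hF0 x), ← ENNReal.ofReal_mul (pow_nonneg (hF0 x) _)]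
      apply ENNReal.ofReal_le_ofReal
      rcases (hF0 x).eq_or_lt with h | h
      · rw [← h]; simp [show n ≠ 0 by omega]
      have hmin : 0 < min (F x) T := lt_min h hT
      have e1 : (min (F x) T) ^ (p - 1) = (min (F x) T) ^ (n-1) * (min (F x) T) ^ (p - n) := by
        rw [← Real.rpow_natCast, ← Real.rpow_add hmin]
        congr 1
        rw [Nat.cast_sub (by omega)]; push_cast; ring
      have e2 : F x ^ n = F x * F x ^ (n-1) := by
        rw [← pow_succ']; congr 1; omega
      rw [e1, e2, mul_assoc]
      gcongr
      exact min_le_left _ _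
    have hfin : Y ≤ ENNReal.ofReal (1/2) * Y + N * ENNReal.ofReal s0 ^ (p-n) := by
      calc Y = ENNReal.ofReal (p - n) * _ := lay1
        _ ≤ ENNReal.ofReal (p - n) * (ENNReal.ofReal M * I2 + N * ENNReal.ofReal (s0 ^ (p-n) / (p - n))) := by gcongr
        _ = ENNReal.ofReal ((p - n) * M) * I2 + N * ENNReal.ofReal (s0 ^ (p-n)) := by
          rw [ENNReal.ofReal_mul hpn.le, mul_add, mul_assoc]
          congr 1
          rw [mul_left_comm, ← ENNReal.ofReal_mul hpn.le, mul_div_cancel₀ _ hpn.ne']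
        _ ≤ ENNReal.ofReal (1/2 * (p - 1)) * I2 + N * ENNReal.ofReal (s0 ^ (p-n)) := by
          gcongr ENNReal.ofReal ?_ * _ + _; linarith
        _ ≤ _ := by
          rw [ENNReal.ofReal_mul (by norm_num), mul_assoc, ENNReal.ofReal_rpow_of_nonneg hs0 hpn.le]
          gcongr
    have h2 : Y = ENNReal.ofReal (1/2) * Y + ENNReal.ofReal (1/2) * Y := by
      rw [← add_mul, ← ENNReal.ofReal_add (by norm_num) (by norm_num)]; norm_num
    have h3 : ENNReal.ofReal (1/2) * Y ≤ N * ENNReal.ofReal s0 ^ (p-n) := by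
      have : ENNReal.ofReal (1/2) * Y + ENNReal.ofReal (1/2) * Y ≤ ENNReal.ofReal (1/2) * Y + N * ENNReal.ofReal s0 ^ (p-n) := by rwa [← h2]
      exact (ENNReal.add_le_add_iff_left (ENNReal.mul_ne_top ofReal_ne_top hYtop)).1 this
    rw [h2, ← two_mul]; gcongr
  -- monotone limit
  have hlim : ∫⁻ x, ENNReal.ofReal (F x) ^ p ∂μ = ∫⁻ x, ⨆ k : ℕ, ENNReal.ofReal (F x) ^ n * ENNReal.ofReal ((min (F x) ((k:ℝ)+1)) ^ (p - n)) ∂μ := by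
    apply lintegral_congr
    intro x
    have hle : ∀ k : ℕ, ENNReal.ofReal (F x) ^ n * ENNReal.ofReal ((min (F x) ((k:ℝ)+1)) ^ (p - n)) ≤ ENNReal.ofReal (F x) ^ n * ENNReal.ofReal ((F x) ^ (p - n)) := by
      intro k
      gcongr
      · exact le_min (hF0 x) (by positivity)
      · exact min_le_left _ _
    have heq : ENNReal.ofReal (F x) ^ p = ENNReal.ofReal (F x) ^ n * ENNReal.ofReal ((F x) ^ (p - n)) := by
      rw [← ENNReal.ofReal_rpow_of_nonneg (hF0 x) hpn.le, ← ENNReal.rpow_natCast, ← ENNReal.rpow_add_of_nonneg _ _ (by positivity) hpn.le]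
      congr 1; ring
    rw [heq]
    apply le_antisymm
    · obtain ⟨k, hk⟩ := exists_nat_gt (F x)
      refine le_trans ?_ (le_iSup _ k)
      rw [min_eq_left (by linarith)]
    · exact iSup_le hle
  rw [hlim, lintegral_iSup]
  · exact iSup_le fun k => key _ (by positivity)
  · intro k
    exact (hF.ennreal_ofReal.pow_const n).mul ((hF.min measurable_const).pow_const _).ennreal_ofReal
  · intro i j hij x
    dsimp only
    gcongr
    exact le_min (hF0 x) (by positivity)

section GehringLocal
variable {E : Type*} [NormedAddCommGroup E] [NormedSpace ℝ E] [FiniteDimensional ℝ E]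
  [MeasurableSpace E] [BorelSpace E] [Nontrivial E] (μ : Measure E) [μ.IsAddHaarMeasure]

lemma closedBall_ae_ball (x : E) (r : ℝ) : (closedBall x r : Set E) =ᵐ[μ] ball x r := by
  rw [← ball_union_sphere]
  exact union_ae_eq_left_of_ae_eq_empty (ae_eq_empty.2 (Measure.addHaar_sphere μ x r))

lemma leb_diff (g : E → ℝ≥0∞) (hg : Measurable g) (hgi : ∫⁻ y, g y ∂μ ≠ ∞) :
    ∀ᵐ x ∂μ, Filter.Tendsto (fun r => (∫⁻ y in ball x r, g y ∂μ) / μ (ball x r))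
      (nhdsWithin 0 (Set.Ioi 0)) (nhds (g x)) := by
  filter_upwards [VitaliFamily.ae_tendsto_lintegral_div (Besicovitch.vitaliFamily μ) hg.aemeasurable hgi] with x hx
  have := hx.comp (Besicovitch.tendsto_filterAt μ x)
  refine this.congr fun r => ?_
  simp only [Function.comp]
  rw [setLIntegral_congr (closedBall_ae_ball μ x r), measure_congr (closedBall_ae_ball μ x r)]

/-- weighted function -/
def wF (f : E → ℝ) (y : E) : ℝ := max (2 - ‖y‖) 0 * f y

lemma wF_nonneg {f : E → ℝ} (hf0 : ∀ y, 0 ≤ f y) (y : E) : 0 ≤ wF f y :=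
  mul_nonneg (le_max_right _ _) (hf0 y)

lemma wF_meas {f : E → ℝ} (hf : Measurable f) : Measurable (wF f) := by
  unfold wF
  exact ((measurable_const.sub measurable_norm).max measurable_const).mul hf

lemma local_est (n : ℕ) (hn : 2 ≤ n) (hE : Module.finrank ℝ E = n) (f : E → ℝ) (hf : Measurable f)
    (hf0 : ∀ y, 0 ≤ f y) (x : E) (hx : ‖x‖ < 2) (C lam s r : ℝ) (hC : 0 < C) (hlam : 0 < lam)
    (hs : 9 * lam = 20 * C * s) (hr : 0 < r) (hr3 : 20 * r ≤ 2 - ‖x‖)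
    (hRH : ((μ (ball x r))⁻¹ * ∫⁻ y in ball x r, ENNReal.ofReal (f y) ^ n ∂μ) ^ ((1 : ℝ) / n)
        ≤ ENNReal.ofReal C * ((μ (ball x (2 * r)))⁻¹ * ∫⁻ y in ball x (2 * r), ENNReal.ofReal (f y) ∂μ))
    (h1 : ENNReal.ofReal lam ^ n ≤ ENNReal.ofReal (2 - ‖x‖) ^ n *
      ((∫⁻ y in ball x r, (ball (0:E) 2).indicator (fun y => ENNReal.ofReal (f y) ^ n) y ∂μ) / μ (ball x r)))
    (h2 : ENNReal.ofReal (2 - ‖x‖) ^ n *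
      ((∫⁻ y in ball x (10 * r), (ball (0:E) 2).indicator (fun y => ENNReal.ofReal (f y) ^ n) y ∂μ) / μ (ball x (10 * r)))
       ≤ ENNReal.ofReal lam ^ n) :
    9 * 2 ^ n * ∫⁻ y in closedBall x (5 * (2 * r)), ENNReal.ofReal (wF f y) ^ n ∂μ ≤
      15 ^ n * 20 * ENNReal.ofReal C * ENNReal.ofReal lam ^ (n-1) *
        ∫⁻ y in closedBall x (2 * r), {y | s < wF f y}.indicator (fun y => ENNReal.ofReal (wF f y)) y ∂μ := by
  have hd : 0 < 2 - ‖x‖ := by linarith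
  set d := 2 - ‖x‖ with hdd
  have hn0 : (n:ℝ) ≠ 0 := by positivity
  set G : E → ℝ≥0∞ := (ball (0:E) 2).indicator (fun y => ENNReal.ofReal (f y) ^ n) with hG
  have hV : ∀ ρ, 0 < ρ → μ (ball x ρ) ≠ 0 := fun ρ h => (measure_ball_pos μ x h).ne'
  have hVt : ∀ ρ, μ (ball x ρ) ≠ ∞ := fun ρ => measure_ball_lt_top.ne
  have hwm := wF_meas hf
  have hw0 := wF_nonneg hf0
  have hnorm : ∀ ρ, ∀ y ∈ ball x ρ, ‖y‖ ≤ ‖x‖ + ρ ∧ ‖x‖ ≤ ‖y‖ + ρ := by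
    intro ρ y hy
    rw [mem_ball, dist_eq_norm] at hy
    have a := norm_sub_norm_le y x
    have b := norm_sub_norm_le x y
    rw [norm_sub_rev] at b
    constructor <;> linarith
  have hGle : ∀ y, G y ≤ ENNReal.ofReal (f y) ^ n := fun y => Set.indicator_le_self _ _ y
  have hs0 : 0 < s := by
    by_contra h; push Not at h
    nlinarith
  -- step a
  have ha : ENNReal.ofReal lam ≤ ENNReal.ofReal d * (ENNReal.ofReal C * ((μ (ball x (2 * r)))⁻¹ * ∫⁻ y in ball x (2 * r), ENNReal.ofReal (f y) ∂μ)) := by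
    have h1' : ENNReal.ofReal lam ^ n ≤ ENNReal.ofReal d ^ n * ((μ (ball x r))⁻¹ * ∫⁻ y in ball x r, ENNReal.ofReal (f y) ^ n ∂μ) := by
      refine h1.trans ?_
      rw [ENNReal.div_eq_inv_mul]
      gcongr with y
      exact hGle y
    have := ENNReal.rpow_le_rpow h1' (z := (1:ℝ)/n) (by positivity)
    rw [ENNReal.mul_rpow_of_nonneg _ _ (by positivity), ← ENNReal.rpow_natCast, ← ENNReal.rpow_natCast (ENNReal.ofReal d), ← ENNReal.rpow_mul, ← ENNReal.rpow_mul,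
      mul_one_div_cancel hn0, ENNReal.rpow_one, ENNReal.rpow_one] at this
    refine this.trans ?_
    gcongr
  -- step b
  set V := μ (ball x (2*r)) with hVdef
  have hV0 : V ≠ 0 := hV _ (by linarith)
  have hVT : V ≠ ∞ := hVt _
  have hb : ENNReal.ofReal lam * V ≤ ENNReal.ofReal C * ∫⁻ y in ball x (2 * r), ENNReal.ofReal d * ENNReal.ofReal (f y) ∂μ := by
    rw [lintegral_const_mul' _ _ ofReal_ne_top]
    calc _ ≤ _ := mul_le_mul_left ha V
      _ = (V⁻¹ * V) * (ENNReal.ofReal C * (ENNReal.ofReal d * ∫⁻ y in ball x (2 * r), ENNReal.ofReal (f y) ∂μ)) := by ring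
      _ = _ := by rw [ENNReal.inv_mul_cancel hV0 hVT, one_mul]
  set W := ∫⁻ y in ball x (2 * r), {y | s < wF f y}.indicator (fun y => ENNReal.ofReal (wF f y)) y ∂μ with hW
  have hc : 9 * ∫⁻ y in ball x (2 * r), ENNReal.ofReal d * ENNReal.ofReal (f y) ∂μ ≤ 10 * (ENNReal.ofReal s * V + W) := by
    have e : ENNReal.ofReal s * V + W = ∫⁻ y in ball x (2 * r), (ENNReal.ofReal s + {y | s < wF f y}.indicator (fun y => ENNReal.ofReal (wF f y)) y) ∂μ := by
      rw [lintegral_add_left measurable_const, setLIntegral_const]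
    rw [e, ← lintegral_const_mul' _ _ (by simp), ← lintegral_const_mul' _ _ (by simp)]
    apply setLIntegral_mono' measurableSet_ball
    intro y hy
    have hy' := (hnorm _ y hy).1
    have h9 : 9 * (d * f y) ≤ 10 * wF f y := by
      unfold wF
      have : 9 * d ≤ 10 * max (2 - ‖y‖) 0 := by
        have := le_max_left (2 - ‖y‖) 0
        linarith
      have := mul_le_mul_of_nonneg_right this (hf0 y)
      linarith
    calc 9 * (ENNReal.ofReal d * ENNReal.ofReal (f y)) = ENNReal.ofReal (9 * (d * f y)) := by
          rw [ENNReal.ofReal_mul (by norm_num), ENNReal.ofReal_mul hd.le]; norm_num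
      _ ≤ ENNReal.ofReal (10 * wF f y) := ENNReal.ofReal_le_ofReal h9
      _ = 10 * ENNReal.ofReal (wF f y) := by rw [ENNReal.ofReal_mul (by norm_num)]; norm_num
      _ ≤ _ := by
        gcongr
        by_cases h : s < wF f y
        · rw [Set.indicator_of_mem (show y ∈ {y | s < wF f y} from h)]
          exact le_add_self
        · exact le_add_right (ENNReal.ofReal_le_ofReal (not_lt.1 h))
  -- step d
  have hd' : 9 * (ENNReal.ofReal lam * V) ≤ 20 * ENNReal.ofReal C * W := by
    have hls : 9 * ENNReal.ofReal lam = 20 * (ENNReal.ofReal C * ENNReal.ofReal s) := by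
      have := congrArg ENNReal.ofReal hs
      rw [mul_assoc, ENNReal.ofReal_mul (by norm_num), ENNReal.ofReal_mul (by norm_num), ENNReal.ofReal_mul hC.le] at this
      norm_num at this
      exact this
    have h18 : 9 * (ENNReal.ofReal lam * V) + 9 * (ENNReal.ofReal lam * V) ≤ 9 * (ENNReal.ofReal lam * V) + 20 * ENNReal.ofReal C * W := by
      calc 9 * (ENNReal.ofReal lam * V) + 9 * (ENNReal.ofReal lam * V) = 2 * (9 * (ENNReal.ofReal lam * V)) := by ring
        _ ≤ 2 * (9 * (ENNReal.ofReal C * ∫⁻ y in ball x (2 * r), ENNReal.ofReal d * ENNReal.ofReal (f y) ∂μ)) := by gcongr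
        _ = 2 * ENNReal.ofReal C * (9 * ∫⁻ y in ball x (2 * r), ENNReal.ofReal d * ENNReal.ofReal (f y) ∂μ) := by ring
        _ ≤ 2 * ENNReal.ofReal C * (10 * (ENNReal.ofReal s * V + W)) := by gcongr
        _ = (20 * (ENNReal.ofReal C * ENNReal.ofReal s)) * V + 20 * ENNReal.ofReal C * W := by ring
        _ = _ := by rw [← hls]; ring
    exact (ENNReal.add_le_add_iff_left (by
      exact ENNReal.mul_ne_top (by simp) (ENNReal.mul_ne_top ofReal_ne_top hVT))).1 h18
  -- step e
  have hV10 : μ (ball x (10 * r)) = 5 ^ n * V := by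
    rw [hVdef, Measure.addHaar_ball μ x (by linarith), Measure.addHaar_ball μ x (by linarith), hE, ← mul_assoc]
    congr 1
    rw [show 10 * r = 5 * (2 * r) by ring, mul_pow 5, ENNReal.ofReal_mul (by positivity), ENNReal.ofReal_pow (by norm_num)]
    norm_num
  have he : 2 ^ n * ∫⁻ y in ball x (10 * r), ENNReal.ofReal (wF f y) ^ n ∂μ ≤ 15 ^ n * ENNReal.ofReal lam ^ n * V := by
    have e1 : 2 ^ n * ∫⁻ y in ball x (10 * r), ENNReal.ofReal (wF f y) ^ n ∂μ ≤ 3 ^ n * (ENNReal.ofReal d ^ n * ∫⁻ y in ball x (10 * r), G y ∂μ) := by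
      rw [← lintegral_const_mul' _ _ (by simp), ← lintegral_const_mul' _ _ (by simp), ← lintegral_const_mul' _ _ (by simp)]
      apply setLIntegral_mono' measurableSet_ball
      intro y hy
      have hy' := (hnorm _ y hy).2
      by_cases hy2 : y ∈ ball (0:E) 2
      · rw [hG, Set.indicator_of_mem hy2, ← mul_pow, ← mul_pow, ← mul_pow]
        refine pow_le_pow_left' ?_ n
        have : 2 * wF f y ≤ 3 * (d * f y) := by
          unfold wF
          have : 2 * max (2 - ‖y‖) 0 ≤ 3 * d := by
            rw [mul_max_of_nonneg _ _ (by norm_num)]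
            apply max_le <;> linarith
          have := mul_le_mul_of_nonneg_right this (hf0 y)
          linarith
        have := ENNReal.ofReal_le_ofReal this
        rw [ENNReal.ofReal_mul (by norm_num), ENNReal.ofReal_mul (by norm_num), ENNReal.ofReal_mul hd.le] at this
        norm_num at this
        exact this
      · have : wF f y = 0 := by
          unfold wF
          rw [mem_ball_zero_iff, not_lt] at hy2
          rw [max_eq_right (by linarith), zero_mul]
        rw [this]; simp [show n ≠ 0 by omega]
    refine e1.trans ?_
    have e2 : ENNReal.ofReal d ^ n * ∫⁻ y in ball x (10 * r), G y ∂μ ≤ ENNReal.ofReal lam ^ n * μ (ball x (10*r)) := by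
      rw [← mul_div_assoc] at h2
      exact (ENNReal.div_le_iff (hV _ (by linarith)) (hVt _)).1 h2
    calc _ ≤ 3 ^ n * (ENNReal.ofReal lam ^ n * μ (ball x (10*r))) := by gcongr
      _ = _ := by
        rw [hV10, show (15:ℝ≥0∞) = 3 * 5 by norm_num, mul_pow]; ring
  rw [show 5 * (2 * r) = 10 * r by ring, setLIntegral_congr (closedBall_ae_ball μ x _), setLIntegral_congr (closedBall_ae_ball μ x _)]
  calc _ = 9 * (2 ^ n * ∫⁻ y in ball x (10 * r), ENNReal.ofReal (wF f y) ^ n ∂μ) := by ring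
    _ ≤ 9 * (15 ^ n * ENNReal.ofReal lam ^ n * V) := by gcongr
    _ = 15 ^ n * ENNReal.ofReal lam ^ (n-1) * (9 * (ENNReal.ofReal lam * V)) := by
      obtain ⟨m, rfl⟩ : ∃ m, n = m + 1 := ⟨n - 1, by omega⟩
      rw [Nat.add_sub_cancel, pow_succ (ENNReal.ofReal lam)]; ring
    _ ≤ 15 ^ n * ENNReal.ofReal lam ^ (n-1) * (20 * ENNReal.ofReal C * W) := by gcongr
    _ = _ := by ring

lemma level_est (n : ℕ) (hn : 2 ≤ n) (hE : Module.finrank ℝ E = n) (f : E → ℝ) (hf : Measurable f)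
    (hf0 : ∀ y, 0 ≤ f y) (C A lam s : ℝ) (hC : 0 < C) (hA0 : 0 ≤ A)
    (hA : ∫⁻ y in ball (0:E) 2, ENNReal.ofReal (f y) ^ n ∂μ = ENNReal.ofReal A ^ n * μ (ball 0 2))
    (hs : 9 * lam = 20 * C * s) (hlam : 40 * A < lam)
    (hRH : ∀ (c : E) (r : ℝ), 0 < r → ball c (2 * r) ⊆ ball 0 2 →
      ((μ (ball c r))⁻¹ * ∫⁻ y in ball c r, ENNReal.ofReal (f y) ^ n ∂μ) ^ ((1 : ℝ) / n)
        ≤ ENNReal.ofReal C * ((μ (ball c (2 * r)))⁻¹ * ∫⁻ y in ball c (2 * r), ENNReal.ofReal (f y) ∂μ)) :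
    9 * 2 ^ n * ∫⁻ y in {y | lam < wF f y}, ENNReal.ofReal (wF f y) ^ n ∂μ ≤
      15 ^ n * 20 * ENNReal.ofReal C * ENNReal.ofReal lam ^ (n-1) *
        ∫⁻ y in {y | s < wF f y}, ENNReal.ofReal (wF f y) ∂μ := by
  have hlam0 : 0 < lam := by linarith
  have hwm := wF_meas hf
  set G : E → ℝ≥0∞ := (ball (0:E) 2).indicator (fun y => ENNReal.ofReal (f y) ^ n) with hG
  have hGm : Measurable G := (hf.ennreal_ofReal.pow_const n).indicator measurableSet_ball
  have hGi : ∫⁻ y, G y ∂μ = ENNReal.ofReal A ^ n * μ (ball 0 2) := by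
    rw [hG, lintegral_indicator measurableSet_ball, hA]
  have hGt : ∫⁻ y, G y ∂μ ≠ ∞ := by
    rw [hGi]; exact ENNReal.mul_ne_top (by simp) measure_ball_lt_top.ne
  have hleb := leb_diff μ G hGm hGt
  set S : Set E := {x | lam < wF f x ∧ Filter.Tendsto (fun r => (∫⁻ y in ball x r, G y ∂μ) / μ (ball x r))
      (nhdsWithin 0 (Set.Ioi 0)) (nhds (G x))} with hS
  have hstopr : ∀ x ∈ S, ∃ r : ℝ, 0 < r ∧ ‖x‖ < 2 ∧ 20 * r ≤ 2 - ‖x‖ ∧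
      ENNReal.ofReal lam ^ n ≤ ENNReal.ofReal (2 - ‖x‖) ^ n * ((∫⁻ y in ball x r, G y ∂μ) / μ (ball x r)) ∧
      ENNReal.ofReal (2 - ‖x‖) ^ n * ((∫⁻ y in ball x (10 * r), G y ∂μ) / μ (ball x (10 * r))) ≤ ENNReal.ofReal lam ^ n := by
    rintro x ⟨hx1, hx2⟩
    have hxn : ‖x‖ < 2 := by
      by_contra h
      unfold wF at hx1
      rw [max_eq_right (by linarith), zero_mul] at hx1
      linarith
    have hd : 0 < 2 - ‖x‖ := by linarith
    have hGx : ENNReal.ofReal lam ^ n < ENNReal.ofReal (2 - ‖x‖) ^ n * G x := by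
      rw [hG, Set.indicator_of_mem (mem_ball_zero_iff.2 hxn), ← mul_pow, ← ENNReal.ofReal_mul hd.le]
      refine ENNReal.pow_right_strictMono (by omega) ?_
      unfold wF at hx1
      rw [max_eq_left hd.le] at hx1
      exact (ENNReal.ofReal_lt_ofReal_iff (by linarith)).2 hx1
    set T : Set ℝ := {r | 0 < r ∧ ENNReal.ofReal lam ^ n < ENNReal.ofReal (2 - ‖x‖) ^ n * ((∫⁻ y in ball x r, G y ∂μ) / μ (ball x r))} with hT
    have hTne : T.Nonempty := by
      have h1 := ENNReal.Tendsto.const_mul (a := ENNReal.ofReal (2 - ‖x‖) ^ n) hx2 (Or.inr (by simp))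
      have h2 := (h1.eventually (lt_mem_nhds hGx)).and self_mem_nhdsWithin
      obtain ⟨r, hr⟩ := h2.exists
      exact ⟨r, hr.2, hr.1⟩
    have hTb : ∀ r ∈ T, 20 * r ≤ 2 - ‖x‖ := by
      rintro r ⟨hr0, hr⟩
      have hr1 : ENNReal.ofReal lam ^ n < ENNReal.ofReal (2 - ‖x‖) ^ n * ((ENNReal.ofReal A ^ n * μ (ball 0 2)) / μ (ball x r)) := by
        refine hr.trans_le ?_
        gcongr
        rw [← hGi]; exact setLIntegral_le_lintegral _ _
      rw [← mul_div_assoc, ENNReal.lt_div_iff_mul_lt (Or.inl (measure_ball_pos μ x hr0).ne') (Or.inl measure_ball_lt_top.ne)] at hr1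
      rw [Measure.addHaar_ball μ x hr0.le, Measure.addHaar_ball μ 0 (by norm_num : (0:ℝ) ≤ 2), hE, ENNReal.ofReal_pow hr0.le, ENNReal.ofReal_pow (by norm_num), ← mul_assoc, ← mul_assoc, ← mul_assoc] at hr1
      have hr2 := lt_of_mul_lt_mul_right' hr1
      rw [← mul_pow, ← mul_pow, ← mul_pow, ← ENNReal.ofReal_mul hlam0.le, ← ENNReal.ofReal_mul hd.le, ← ENNReal.ofReal_mul (by positivity)] at hr2
      have hr3 := lt_of_pow_lt_pow_left' n hr2
      have hr4 := (ENNReal.ofReal_lt_ofReal_iff_of_nonneg (by positivity)).1 hr3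
      by_contra hcon
      push Not at hcon
      have : 40 * A * r ≤ lam * r := by gcongr
      nlinarith
    have hTbdd : BddAbove T := ⟨(2 - ‖x‖)/20, fun r hr => by linarith [hTb r hr]⟩
    have hsup : 0 < sSup T := by
      obtain ⟨r, hr⟩ := hTne
      exact lt_of_lt_of_le hr.1 (le_csSup hTbdd hr)
    obtain ⟨r, hrT, hr⟩ := exists_lt_of_lt_csSup hTne (show sSup T / 10 < sSup T by linarith)
    refine ⟨r, hrT.1, hxn, hTb r hrT, hrT.2.le, ?_⟩
    by_contra hcon
    have : 10 * r ∈ T := ⟨by linarith [hrT.1], not_le.1 hcon⟩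
    have := le_csSup hTbdd this
    linarith
  choose! ρ hρ using hstopr
  obtain ⟨u, huS, hud, huc⟩ := Vitali.exists_disjoint_subfamily_covering_enlargement_closedBall S (fun x => x) (fun x => 2 * ρ x) 1
    (fun x hx => by have := (hρ x hx).2.2.1; have := norm_nonneg x; linarith) 5 (by norm_num)
  have hucount : u.Countable := hud.countable_of_nonempty_interior fun x hx =>
    ⟨x, ball_subset_interior_closedBall (mem_ball_self (by linarith [(hρ x (huS hx)).1]))⟩
  have := hucount.to_subtype
  have hcov : ∫⁻ y in {y | lam < wF f y}, ENNReal.ofReal (wF f y) ^ n ∂μ ≤ ∑' x : u, ∫⁻ y in closedBall (x:E) (5 * (2 * ρ x)), ENNReal.ofReal (wF f y) ^ n ∂μ := by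
    refine le_trans ?_ (lintegral_iUnion_le _ _)
    have : ({y | lam < wF f y} : Set E) ≤ᵐ[μ] ⋃ x : u, closedBall (x:E) (5 * (2 * ρ x)) := by
      filter_upwards [hleb] with y hy hy2
      have hyS : y ∈ S := ⟨hy2, hy⟩
      obtain ⟨b, hb, hb2⟩ := huc y hyS
      exact Set.mem_iUnion.2 ⟨⟨b, hb⟩, hb2 (mem_closedBall_self (by linarith [(hρ y hyS).1]))⟩
    exact lintegral_mono' (Measure.restrict_mono_ae this) le_rfl
  calc _ ≤ 9 * 2 ^ n * ∑' x : u, ∫⁻ y in closedBall (x:E) (5 * (2 * ρ x)), ENNReal.ofReal (wF f y) ^ n ∂μ := by gcongr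
    _ = ∑' x : u, 9 * 2 ^ n * ∫⁻ y in closedBall (x:E) (5 * (2 * ρ x)), ENNReal.ofReal (wF f y) ^ n ∂μ := ENNReal.tsum_mul_left.symm
    _ ≤ ∑' x : u, 15 ^ n * 20 * ENNReal.ofReal C * ENNReal.ofReal lam ^ (n-1) *
        ∫⁻ y in closedBall (x:E) (2 * ρ x), {y | s < wF f y}.indicator (fun y => ENNReal.ofReal (wF f y)) y ∂μ := by
      refine ENNReal.tsum_le_tsum fun x => ?_
      obtain ⟨a1, a2, a3, a4, a5⟩ := hρ x (huS x.2)
      refine local_est μ n hn hE f hf hf0 x a2 C lam s (ρ x) hC hlam0 hs a1 a3 (hRH _ _ a1 ?_) a4 a5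
      apply ball_subset_ball'
      rw [dist_zero_right]; linarith
    _ = 15 ^ n * 20 * ENNReal.ofReal C * ENNReal.ofReal lam ^ (n-1) *
        ∫⁻ y in ⋃ x ∈ u, closedBall (x:E) (2 * ρ x), {y | s < wF f y}.indicator (fun y => ENNReal.ofReal (wF f y)) y ∂μ := by
      rw [ENNReal.tsum_mul_left, lintegral_biUnion hucount (fun _ _ => measurableSet_closedBall) hud]
    _ ≤ _ := by
      gcongr _ * ?_
      refine (setLIntegral_le_lintegral _ _).trans ?_
      rw [lintegral_indicator (measurableSet_lt measurable_const hwm)]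

lemma C_ge_one (n : ℕ) (hn : 2 ≤ n) (f : E → ℝ) (hf : Measurable f)
    (hf0 : ∀ y, 0 ≤ f y) (C : ℝ) (hC : 0 < C) (hC1 : C < 1)
    (hA : ∫⁻ y in ball (0:E) 2, ENNReal.ofReal (f y) ^ n ∂μ ≠ ∞)
    (hRH : ∀ (c : E) (r : ℝ), 0 < r → ball c (2 * r) ⊆ ball 0 2 →
      ((μ (ball c r))⁻¹ * ∫⁻ y in ball c r, ENNReal.ofReal (f y) ^ n ∂μ) ^ ((1 : ℝ) / n)
        ≤ ENNReal.ofReal C * ((μ (ball c (2 * r)))⁻¹ * ∫⁻ y in ball c (2 * r), ENNReal.ofReal (f y) ∂μ)) :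
    ∀ᵐ y ∂μ, y ∈ ball (0:E) 2 → f y = 0 := by
  have hn0 : (n:ℝ) ≠ 0 := by positivity
  set G : E → ℝ≥0∞ := (ball (0:E) 2).indicator (fun y => ENNReal.ofReal (f y) ^ n) with hG
  set H : E → ℝ≥0∞ := (ball (0:E) 2).indicator (fun y => ENNReal.ofReal (f y)) with hH
  have hGm : Measurable G := (hf.ennreal_ofReal.pow_const n).indicator measurableSet_ball
  have hHm : Measurable H := hf.ennreal_ofReal.indicator measurableSet_ball
  have hGi : ∫⁻ y, G y ∂μ ≠ ∞ := by
    rwa [hG, lintegral_indicator measurableSet_ball]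
  have hHi : ∫⁻ y, H y ∂μ ≠ ∞ := by
    rw [hH, lintegral_indicator measurableSet_ball]
    have : ∫⁻ y in ball (0:E) 2, ENNReal.ofReal (f y) ∂μ ≤ ∫⁻ y in ball (0:E) 2, (1 + ENNReal.ofReal (f y) ^ n) ∂μ := by
      apply lintegral_mono
      intro y
      dsimp only
      rcases le_total (ENNReal.ofReal (f y)) 1 with h | h
      · exact le_add_right h
      · exact le_add_left (le_self_pow h (by omega))
    refine ne_top_of_le_ne_top ?_ this
    rw [lintegral_add_left measurable_const, setLIntegral_const, one_mul]
    exact ENNReal.add_ne_top.2 ⟨measure_ball_lt_top.ne, hA⟩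
  filter_upwards [leb_diff μ G hGm hGi, leb_diff μ H hHm hHi] with x h1 h2 hx
  have hxn := mem_ball_zero_iff.1 hx
  have t2 : Filter.Tendsto (fun r : ℝ => 2 * r) (nhdsWithin 0 (Set.Ioi 0)) (nhdsWithin 0 (Set.Ioi 0)) := by
    refine tendsto_nhdsWithin_iff.2 ⟨?_, ?_⟩
    · have : Filter.Tendsto (fun r : ℝ => 2 * r) (nhds 0) (nhds (2 * 0)) := (continuous_const.mul continuous_id).tendsto 0
      rw [mul_zero] at this
      exact this.mono_left nhdsWithin_le_nhds
    · filter_upwards [self_mem_nhdsWithin] with r hr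
      have : (0:ℝ) < r := hr
      simp [this]
  have l1 := h1.ennrpow_const ((1:ℝ)/n)
  have l2 := ENNReal.Tendsto.const_mul (a := ENNReal.ofReal C) (h2.comp t2) (Or.inr (by simp))
  have hle : G x ^ ((1:ℝ)/n) ≤ ENNReal.ofReal C * H x := by
    refine le_of_tendsto_of_tendsto l1 l2 ?_
    have hsm : Set.Ioo (0:ℝ) ((2 - ‖x‖)/2) ∈ nhdsWithin (0:ℝ) (Set.Ioi 0) := Ioo_mem_nhdsGT (by linarith)
    filter_upwards [hsm] with r hr
    have hsub : ball x (2 * r) ⊆ ball (0:E) 2 := by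
      apply ball_subset_ball'
      rw [dist_zero_right]; linarith [hr.2]
    have hsub1 : ball x r ⊆ ball (0:E) 2 := (ball_subset_ball (by linarith [hr.1])).trans hsub
    have e1 : ∫⁻ y in ball x r, G y ∂μ = ∫⁻ y in ball x r, ENNReal.ofReal (f y) ^ n ∂μ :=
      setLIntegral_congr_fun measurableSet_ball fun y hy => Set.indicator_of_mem (hsub1 hy) _
    have e2 : ∫⁻ y in ball x (2 * r), H y ∂μ = ∫⁻ y in ball x (2 * r), ENNReal.ofReal (f y) ∂μ :=
      setLIntegral_congr_fun measurableSet_ball fun y hy => Set.indicator_of_mem (hsub hy) _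
    simp only [Function.comp]
    rw [e1, e2, ENNReal.div_eq_inv_mul, ENNReal.div_eq_inv_mul]
    exact hRH x r hr.1 hsub
  rw [hG, hH, Set.indicator_of_mem hx, Set.indicator_of_mem hx, ← ENNReal.rpow_natCast, ← ENNReal.rpow_mul,
    mul_one_div_cancel hn0, ENNReal.rpow_one, ← ENNReal.ofReal_mul hC.le,
    ENNReal.ofReal_le_ofReal_iff (mul_nonneg hC.le (hf0 x))] at hle
  nlinarith [hf0 x]

lemma const_ineq (n : ℕ) (C s : ℝ) (hn : 2 ≤ n) (hC : 1 ≤ C) (hs : 0 ≤ s) :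
    (15 ^ n * 20 * C + 9 * 2 ^ n) * (20 / 9 * C * s) ^ (n-1) ≤ 9 * 2 ^ n * (200 ^ n * C ^ n * s ^ (n-1)) := by
  have a1 : (15 ^ n * 20 * C + 9 * 2 ^ n : ℝ) ≤ 29 * 15 ^ n * C := by
    have : (2:ℝ) ^ n ≤ 15 ^ n := pow_le_pow_left₀ (by norm_num) (by norm_num) n
    have h15 : (0:ℝ) < 15 ^ n := by positivity
    nlinarith
  have a2 : (20 / 9 * C * s) ^ (n-1) ≤ 3 ^ n * (C ^ (n-1) * s ^ (n-1)) := by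
    rw [mul_pow, mul_pow, mul_assoc]
    gcongr
    calc ((20:ℝ)/9) ^ (n-1) ≤ 3 ^ (n-1) := pow_le_pow_left₀ (by norm_num) (by norm_num) _
      _ ≤ 3 ^ n := pow_le_pow_right₀ (by norm_num) (by omega)
  have a3 : C ^ n = C * C ^ (n-1) := by rw [← pow_succ']; congr 1; omega
  have a4 : (29:ℝ) * 15 ^ n * 3 ^ n ≤ 9 * 2 ^ n * 200 ^ n := by
    rw [mul_assoc, mul_assoc, ← mul_pow, ← mul_pow]
    have : (4:ℝ) ≤ 4 ^ n := le_self_pow₀ (by norm_num) (by omega)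
    have h2 : (4:ℝ) ^ n * (15 * 3) ^ n ≤ (2 * 200) ^ n := by
      rw [← mul_pow]; exact pow_le_pow_left₀ (by norm_num) (by norm_num) n
    have h3 : (0:ℝ) < (15*3) ^ n := by positivity
    nlinarith
  calc _ ≤ (29 * 15 ^ n * C) * (3 ^ n * (C ^ (n-1) * s ^ (n-1))) := by gcongr
    _ = (29 * 15 ^ n * 3 ^ n) * (C * C ^ (n-1) * s ^ (n-1)) := by ring
    _ ≤ (9 * 2 ^ n * 200 ^ n) * (C * C ^ (n-1) * s ^ (n-1)) := by gcongr
    _ = _ := by rw [a3]; ring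

lemma gehring_main (n : ℕ) (hn : 2 ≤ n) (hE : Module.finrank ℝ E = n) (f : E → ℝ) (hf : Measurable f)
    (hf0 : ∀ y, 0 ≤ f y) (C A : ℝ) (hC : 1 ≤ C) (hA0 : 0 ≤ A)
    (hA : ∫⁻ y in ball (0:E) 2, ENNReal.ofReal (f y) ^ n ∂μ = ENNReal.ofReal A ^ n * μ (ball 0 2))
    (hRH : ∀ (c : E) (r : ℝ), 0 < r → ball c (2 * r) ⊆ ball 0 2 →
      ((μ (ball c r))⁻¹ * ∫⁻ y in ball c r, ENNReal.ofReal (f y) ^ n ∂μ) ^ ((1 : ℝ) / n)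
        ≤ ENNReal.ofReal C * ((μ (ball c (2 * r)))⁻¹ * ∫⁻ y in ball c (2 * r), ENNReal.ofReal (f y) ∂μ))
    (p : ℝ) (hp : (n : ℝ) < p)
    (hp' : p < n + (n - 1) / ((10 : ℝ) ^ (2 * n) * 4 ^ n * C ^ n)) :
    ((μ (ball (0 : E) 1))⁻¹ * ∫⁻ x in ball (0 : E) 1, ENNReal.ofReal (f x) ^ p ∂μ) ^ (1 / p)
      ≤ ENNReal.ofReal (144 * A) := by
  have hC0 : 0 < C := by linarith
  have hn' : (2:ℝ) ≤ n := by exact_mod_cast hn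
  have hp0 : 0 < p := by linarith
  have hpn : 0 < p - n := by linarith
  have hwm := wF_meas hf
  have hw0 := wF_nonneg hf0
  have hms : ∀ t, MeasurableSet {y | t < wF f y} := fun t => measurableSet_lt measurable_const hwm
  have hN : ∫⁻ y, ENNReal.ofReal (wF f y) ^ n ∂μ ≤ 2 ^ n * (ENNReal.ofReal A ^ n * μ (ball 0 2)) := by
    rw [← hA, ← lintegral_const_mul' _ _ (by simp), ← lintegral_indicator measurableSet_ball]
    apply lintegral_mono
    intro y
    dsimp only
    by_cases hy : y ∈ ball (0:E) 2
    · rw [Set.indicator_of_mem hy, ← mul_pow]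
      refine pow_le_pow_left' ?_ n
      rw [show (2:ℝ≥0∞) = ENNReal.ofReal 2 by norm_num, ← ENNReal.ofReal_mul (by norm_num)]
      apply ENNReal.ofReal_le_ofReal
      unfold wF
      have := hf0 y
      gcongr
      exact max_le (by linarith [norm_nonneg y]) (by norm_num)
    · rw [Set.indicator_of_notMem hy]
      rw [mem_ball_zero_iff, not_lt] at hy
      unfold wF
      rw [max_eq_right (by linarith)]
      simp [show n ≠ 0 by omega]
  have hNt : ∫⁻ y, ENNReal.ofReal (wF f y) ^ n ∂μ ≠ ∞ := by
    refine ne_top_of_le_ne_top ?_ hN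
    exact ENNReal.mul_ne_top (by simp) (ENNReal.mul_ne_top (by simp) measure_ball_lt_top.ne)
  have main := gehring_abs μ n hn (wF f) hwm hw0 _ rfl hNt (200 ^ n * C ^ n) (18 * A / C) (by positivity)
    (by positivity) ?_ p hp ?_
  · have hs0 : ENNReal.ofReal (18 * A / C) ≤ ENNReal.ofReal (18 * A) := by
      apply ENNReal.ofReal_le_ofReal
      exact div_le_self (by positivity) hC
    have hf1 : ∫⁻ x in ball (0 : E) 1, ENNReal.ofReal (f x) ^ p ∂μ ≤ ∫⁻ x, ENNReal.ofReal (wF f x) ^ p ∂μ := by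
      refine le_trans ?_ (setLIntegral_le_lintegral (ball (0:E) 1) _)
      apply setLIntegral_mono' measurableSet_ball
      intro y hy
      rw [mem_ball_zero_iff] at hy
      gcongr
      unfold wF
      exact le_mul_of_one_le_left (hf0 y) (le_max_of_le_left (by linarith))
    have hV : μ (ball (0:E) 2) = 2 ^ n * μ (ball (0:E) 1) := by
      rw [Measure.addHaar_ball μ 0 (by norm_num : (0:ℝ) ≤ 2), hE, ENNReal.ofReal_pow (by norm_num)]; norm_num
    have hV0 : μ (ball (0:E) 1) ≠ 0 := (measure_ball_pos μ 0 one_pos).ne'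
    have hVT : μ (ball (0:E) 1) ≠ ∞ := measure_ball_lt_top.ne
    have hfin : (μ (ball (0 : E) 1))⁻¹ * ∫⁻ x in ball (0 : E) 1, ENNReal.ofReal (f x) ^ p ∂μ ≤ ENNReal.ofReal (144 * A) ^ p := by
      calc _ ≤ (μ (ball (0 : E) 1))⁻¹ * (2 * (2 ^ n * (ENNReal.ofReal A ^ n * (2 ^ n * μ (ball (0:E) 1))) * ENNReal.ofReal (18 * A) ^ (p - n))) := by
            rw [← hV]
            gcongr
            refine hf1.trans (main.trans ?_)
            gcongr
        _ = ((μ (ball (0 : E) 1))⁻¹ * μ (ball (0:E) 1)) * (2 * (2 ^ n * (ENNReal.ofReal A ^ n * 2 ^ n) * ENNReal.ofReal (18 * A) ^ (p - n))) := by ring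
        _ = ENNReal.ofReal (2 * (2 ^ n * (A ^ n * 2 ^ n) * (18 * A) ^ (p - n))) := by
          rw [ENNReal.inv_mul_cancel hV0 hVT, one_mul, ENNReal.ofReal_rpow_of_nonneg (by positivity) hpn.le,
            ENNReal.ofReal_mul (p := 2) (by norm_num), ENNReal.ofReal_mul (p := 2 ^ n * (A ^ n * 2 ^ n)) (by positivity),
            ENNReal.ofReal_mul (p := 2 ^ n) (by positivity), ENNReal.ofReal_mul (p := A ^ n) (by positivity),
            ENNReal.ofReal_pow (p := 2) (by norm_num), ENNReal.ofReal_pow hA0]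
          norm_num
        _ ≤ ENNReal.ofReal ((144 * A) ^ p) := by
          apply ENNReal.ofReal_le_ofReal
          rcases hA0.eq_or_lt with h | h
          · rw [← h]; simp [show n ≠ 0 by omega]; positivity
          have e1 : (2:ℝ) ≤ 2 ^ p := by
            conv_lhs => rw [← Real.rpow_one 2]
            exact Real.rpow_le_rpow_of_exponent_le (by norm_num) (by linarith)
          have e2 : (2:ℝ) ^ n ≤ 2 ^ p := by
            rw [← Real.rpow_natCast]
            exact Real.rpow_le_rpow_of_exponent_le (by norm_num) hp.le
          have e3 : A ^ n * (18 * A) ^ (p - n) ≤ 18 ^ p * A ^ p := by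
            rw [Real.mul_rpow (by norm_num) hA0]
            have : A ^ p = A ^ n * A ^ (p - n) := by
              rw [← Real.rpow_natCast, ← Real.rpow_add h]; congr 1; ring
            rw [this]
            have e4 : (18:ℝ) ^ (p - n) ≤ 18 ^ p := Real.rpow_le_rpow_of_exponent_le (by norm_num) (by linarith)
            calc _ = 18 ^ (p - n) * (A ^ n * A ^ (p - n)) := by ring
              _ ≤ _ := by gcongr
          have e5 : (144 * A) ^ p = 2 ^ p * (2 ^ p * 2 ^ p * (18 ^ p * A ^ p)) := by
            rw [← Real.mul_rpow (by norm_num) hA0, ← Real.mul_rpow (by norm_num) (by norm_num), ← Real.mul_rpow (by norm_num) (by positivity), ← Real.mul_rpow (by norm_num) (by positivity)]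
            congr 1; ring
          rw [e5]
          calc _ = 2 * (2 ^ n * 2 ^ n * (A ^ n * (18 * A) ^ (p - n))) := by ring
            _ ≤ _ := by gcongr
        _ = _ := (ENNReal.ofReal_rpow_of_nonneg (by positivity) hp0.le).symm
    calc _ ≤ (ENNReal.ofReal (144 * A) ^ p) ^ (1/p) := by gcongr
      _ = _ := by rw [← ENNReal.rpow_mul, mul_one_div_cancel hp0.ne', ENNReal.rpow_one]
  · intro s hs
    have hs0 : 0 ≤ s := le_trans (by positivity) hs.le
    set lam := 20 / 9 * C * s with hlam
    have hlam0 : 0 ≤ lam := by positivity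
    have hlev := level_est μ n hn hE f hf hf0 C A lam s hC0 hA0 hA (by rw [hlam]; ring) (by
      rw [div_lt_iff₀ hC0] at hs
      rw [hlam]; nlinarith) hRH
    clear_value lam
    set W := ∫⁻ y in {y | s < wF f y}, ENNReal.ofReal (wF f y) ∂μ with hW
    have hsplit : ∫⁻ y in {y | s < wF f y}, ENNReal.ofReal (wF f y) ^ n ∂μ ≤
        ∫⁻ y in {y | lam < wF f y}, ENNReal.ofReal (wF f y) ^ n ∂μ + ENNReal.ofReal lam ^ (n-1) * W := by
      have e : ∫⁻ y in {y | s < wF f y}, ENNReal.ofReal (wF f y) ^ n ∂μ ≤ ∫⁻ y in {y | s < wF f y},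
          ({y | lam < wF f y}.indicator (fun y => ENNReal.ofReal (wF f y) ^ n) y + ENNReal.ofReal lam ^ (n-1) * ENNReal.ofReal (wF f y)) ∂μ := by
        apply lintegral_mono
        intro y
        dsimp only
        by_cases h : lam < wF f y
        · rw [Set.indicator_of_mem (show y ∈ {y | lam < wF f y} from h)]
          exact le_add_right le_rfl
        · refine le_add_left ?_
          have : ENNReal.ofReal (wF f y) ^ n = ENNReal.ofReal (wF f y) ^ (n-1) * ENNReal.ofReal (wF f y) := by
            rw [← pow_succ]; congr 1; omega
          rw [this]
          gcongr
          exact not_lt.1 h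
      refine e.trans ?_
      rw [lintegral_add_left ((hwm.ennreal_ofReal.pow_const n).indicator (hms lam)), lintegral_const_mul' _ _ (by simp)]
      gcongr ?_ + _
      refine (setLIntegral_le_lintegral _ _).trans ?_
      rw [lintegral_indicator (hms lam)]
    have h9 : 9 * 2 ^ n * ∫⁻ y in {y | s < wF f y}, ENNReal.ofReal (wF f y) ^ n ∂μ ≤ 9 * 2 ^ n * (ENNReal.ofReal (200 ^ n * C ^ n * s ^ (n-1)) * W) := by
      calc _ ≤ 9 * 2 ^ n * (∫⁻ y in {y | lam < wF f y}, ENNReal.ofReal (wF f y) ^ n ∂μ + ENNReal.ofReal lam ^ (n-1) * W) := by gcongr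
        _ ≤ 15 ^ n * 20 * ENNReal.ofReal C * ENNReal.ofReal lam ^ (n-1) * W + 9 * 2 ^ n * (ENNReal.ofReal lam ^ (n-1) * W) := by
          rw [mul_add]; gcongr
        _ = (15 ^ n * 20 * ENNReal.ofReal C + 9 * 2 ^ n) * ENNReal.ofReal lam ^ (n-1) * W := by ring
        _ = ENNReal.ofReal ((15 ^ n * 20 * C + 9 * 2 ^ n) * lam ^ (n-1)) * W := by
          rw [ENNReal.ofReal_mul (by positivity), ENNReal.ofReal_add (by positivity) (by positivity), ENNReal.ofReal_mul (by positivity), ENNReal.ofReal_mul (by positivity),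
            ENNReal.ofReal_mul (by positivity), ENNReal.ofReal_pow (by positivity), ENNReal.ofReal_pow (by positivity), ENNReal.ofReal_pow (by positivity)]
          norm_num
        _ ≤ ENNReal.ofReal (9 * 2 ^ n * (200 ^ n * C ^ n * s ^ (n-1))) * W := by
          gcongr ENNReal.ofReal ?_ * _
          rw [hlam]; exact const_ineq n C s hn hC hs0
        _ = _ := by
          rw [ENNReal.ofReal_mul (by positivity), ENNReal.ofReal_mul (by positivity), ENNReal.ofReal_pow (by positivity), mul_assoc]
          norm_num
    exact (ENNReal.mul_le_mul_iff_right (by simp) (ENNReal.mul_ne_top (by simp) (by simp))).1 h9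
  · have h1 : (p - n) < (n - 1) / ((10 : ℝ) ^ (2 * n) * 4 ^ n * C ^ n) := by linarith
    rw [lt_div_iff₀ (by positivity)] at h1
    have h2 : (10 : ℝ) ^ (2 * n) * 4 ^ n = 2 ^ n * 200 ^ n := by
      rw [pow_mul, ← mul_pow, ← mul_pow]; norm_num
    rw [h2] at h1
    have h3 : (2:ℝ) ≤ 2 ^ n := le_self_pow₀ (by norm_num) (by omega)
    refine le_trans ?_ h1.le
    calc 2 * (200 ^ n * C ^ n * (p - n)) ≤ 2 ^ n * (200 ^ n * C ^ n * (p - n)) := by gcongr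
      _ = _ := by ring

end GehringLocal

/-- Theorem 4.4: Gehring-type higher integrability for the differential
of a `K`-quasiconformal map, with explicit constant `C(n,p) = 2^{1+n/p}·100ⁿ`, for any
`p` with `n < p < n + (n-1)/(10^{2n} 4ⁿ C₁ⁿ)`, where `C₁` is the constant in the
reduced reverse Hölder inequality for `|Dφ|`. -/
theorem higher_integrability_of_quasiconformal_derivative
    (n : ℕ) (hn : 2 ≤ n)
    (Ω : Set (EuclideanSpace ℝ (Fin n))) (hΩopen : IsOpen Ω)
    (hΩconn : IsConnected Ω) (hΩbdd : Bornology.IsBounded Ω)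
    (hB2 : ball (0 : EuclideanSpace ℝ (Fin n)) 2 ⊆ Ω)
    (φ : EuclideanSpace ℝ (Fin n) → EuclideanSpace ℝ (Fin n))
    (K : ℝ) (hK : 1 ≤ K)
    (hdiff : ∀ᵐ x ∂(volume.restrict Ω), DifferentiableAt ℝ φ x)
    (hqc : ∀ᵐ x ∂(volume.restrict Ω), ‖fderiv ℝ φ x‖ ^ (n : ℝ) ≤ K * |(fderiv ℝ φ x).det|)
    (C₁ : ℝ) (hC₁ : 0 < C₁)
    (hRH : ∀ (c : EuclideanSpace ℝ (Fin n)) (ρ : ℝ), 0 < ρ → ball c (2 * ρ) ⊆ Ω →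
      ((volume (ball c ρ))⁻¹ *
          ∫⁻ x in ball c ρ, ENNReal.ofReal (‖fderiv ℝ φ x‖ ^ (n : ℝ))) ^ ((1 : ℝ) / n)
        ≤ ENNReal.ofReal C₁ *
          ((volume (ball c (2 * ρ)))⁻¹ *
            ∫⁻ x in ball c (2 * ρ), ENNReal.ofReal ‖fderiv ℝ φ x‖))
    (p : ℝ) (hp : (n : ℝ) < p)
    (hp' : p < n + (n - 1) / ((10 : ℝ) ^ (2 * n) * 4 ^ n * C₁ ^ n)) :
    ((volume (ball (0 : EuclideanSpace ℝ (Fin n)) 1))⁻¹ *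
        ∫⁻ x in ball (0 : EuclideanSpace ℝ (Fin n)) 1,
          ENNReal.ofReal (‖fderiv ℝ φ x‖ ^ p)) ^ (1 / p)
      ≤ ENNReal.ofReal ((2 : ℝ) ^ (1 + (n : ℝ) / p) * 100 ^ (n : ℕ)) *
        ((volume (ball (0 : EuclideanSpace ℝ (Fin n)) 2))⁻¹ *
          ∫⁻ x in ball (0 : EuclideanSpace ℝ (Fin n)) 2,
            ENNReal.ofReal (‖fderiv ℝ φ x‖ ^ (n : ℝ))) ^ ((1 : ℝ) / n) := by
  have hn0 : (n:ℝ) ≠ 0 := by positivity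
  have hn' : (2:ℝ) ≤ n := by exact_mod_cast hn
  have hp0 : 0 < p := by linarith
  have hE : Module.finrank ℝ (EuclideanSpace ℝ (Fin n)) = n := by simp
  have : Nontrivial (EuclideanSpace ℝ (Fin n)) := Module.nontrivial_of_finrank_pos (R := ℝ) (by omega)
  set f : EuclideanSpace ℝ (Fin n) → ℝ := fun x => ‖fderiv ℝ φ x‖ with hfdef
  have hf : Measurable f := (measurable_fderiv ℝ φ).norm
  have hf0 : ∀ x, 0 ≤ f x := fun x => norm_nonneg _
  have e1 : ∀ x, ENNReal.ofReal (‖fderiv ℝ φ x‖ ^ (n:ℝ)) = ENNReal.ofReal (f x) ^ n := by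
    intro x
    rw [Real.rpow_natCast, ENNReal.ofReal_pow (norm_nonneg _)]
  have e2 : ∀ x, ENNReal.ofReal (‖fderiv ℝ φ x‖ ^ p) = ENNReal.ofReal (f x) ^ p := by
    intro x
    rw [ENNReal.ofReal_rpow_of_nonneg (norm_nonneg _) hp0.le]
  have e3 : ∀ x, ENNReal.ofReal ‖fderiv ℝ φ x‖ = ENNReal.ofReal (f x) := fun _ => rfl
  simp only [e1, e2, e3] at hRH ⊢
  have hRH' : ∀ (c : EuclideanSpace ℝ (Fin n)) (r : ℝ), 0 < r → ball c (2 * r) ⊆ ball 0 2 →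
      ((volume (ball c r))⁻¹ * ∫⁻ y in ball c r, ENNReal.ofReal (f y) ^ n) ^ ((1 : ℝ) / n)
        ≤ ENNReal.ofReal C₁ * ((volume (ball c (2 * r)))⁻¹ * ∫⁻ y in ball c (2 * r), ENNReal.ofReal (f y)) :=
    fun c r hr hs => hRH c r hr (hs.trans hB2)
  have hV0 : volume (ball (0 : EuclideanSpace ℝ (Fin n)) 2) ≠ 0 := (measure_ball_pos volume 0 two_pos).ne'
  have hVT : volume (ball (0 : EuclideanSpace ℝ (Fin n)) 2) ≠ ∞ := measure_ball_lt_top.ne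
  have hcpos : 0 < (2 : ℝ) ^ (1 + (n : ℝ) / p) * 100 ^ (n : ℕ) := by positivity
  by_cases hfin : ∫⁻ x in ball (0 : EuclideanSpace ℝ (Fin n)) 2, ENNReal.ofReal (f x) ^ n = ∞
  · rw [hfin, ENNReal.mul_top (ENNReal.inv_ne_zero.2 hVT), ENNReal.top_rpow_of_pos (by positivity),
      ENNReal.mul_top (by simpa using hcpos)]
    exact le_top
  rcases lt_or_ge C₁ 1 with hC | hC
  · have hz := C_ge_one volume n hn f hf hf0 C₁ hC₁ hC hfin hRH'
    have hz2 : ∫⁻ x in ball (0 : EuclideanSpace ℝ (Fin n)) 1, ENNReal.ofReal (f x) ^ p = 0 := by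
      rw [← lintegral_zero (μ := volume.restrict (ball (0 : EuclideanSpace ℝ (Fin n)) 1))]
      apply lintegral_congr_ae
      filter_upwards [ae_restrict_mem measurableSet_ball, ae_restrict_of_ae hz] with x hx hx2
      rw [hx2 (ball_subset_ball (by norm_num) hx)]
      simp [hp0]
    rw [hz2, mul_zero, ENNReal.zero_rpow_of_pos (by positivity)]
    exact zero_le
  · set I := (volume (ball (0 : EuclideanSpace ℝ (Fin n)) 2))⁻¹ *
          ∫⁻ x in ball (0 : EuclideanSpace ℝ (Fin n)) 2, ENNReal.ofReal (f x) ^ n with hI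
    have hIT : I ≠ ∞ := ENNReal.mul_ne_top (ENNReal.inv_ne_top.2 hV0) hfin
    have hIr : I ^ ((1:ℝ)/n) ≠ ∞ := ENNReal.rpow_ne_top_of_nonneg (by positivity) hIT
    have hA : ENNReal.ofReal (I ^ ((1:ℝ)/n)).toReal = I ^ ((1:ℝ)/n) := ENNReal.ofReal_toReal hIr
    have main := gehring_main volume n hn hE f hf hf0 C₁ (I ^ ((1:ℝ)/n)).toReal hC ENNReal.toReal_nonneg (by
      rw [hA, ← ENNReal.rpow_natCast, ← ENNReal.rpow_mul, one_div_mul_cancel hn0, ENNReal.rpow_one, hI, mul_comm _ (volume _), ← mul_assoc,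
        ENNReal.mul_inv_cancel hV0 hVT, one_mul]) hRH' p hp hp'
    refine main.trans ?_
    rw [ENNReal.ofReal_mul (by norm_num), hA]
    gcongr
    have h1 : (2:ℝ) ≤ 2 ^ (1 + (n : ℝ) / p) := by
      conv_lhs => rw [← Real.rpow_one 2]
      exact Real.rpow_le_rpow_of_exponent_le (by norm_num) (by linarith [show 0 ≤ (n:ℝ)/p by positivity])
    have h2 : (100:ℝ) ^ 2 ≤ 100 ^ n := pow_le_pow_right₀ (by norm_num) hn
    nlinarith
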